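/- Let 𝔷 : I × ℝ → ℂ be smooth and 2π-periodic in α with 𝔷_α ≠ 0 and, for each t in the interval I, 𝔷(t,·) injective on [0,2π) parametrizing a simple closed curve Γ(t) containing the origin in its simply connected interior Ω(t), with enclosed area |Ω(t)| = π; let H = H(t) be the associated Hilbert transform and suppose H(conj(𝔷_t)) = conj(𝔷_t). Let k and L be as in the definition of the Riemann-type coordinate change: k(t,α) − α is smooth and 2π-periodic, e^{L} = conj(𝔷) e^{ik}, and (I − H)L = 0; and suppose F(t,·) is holomorphic and nonvanishing on Ω(t), continuous on its closure, with F(t, 𝔷(t,α)) = conj(𝔷(t,α)) e^{i k(t,α)} and F(t,0) ∈ ℝ₊. Set ε := |𝔷|² − 1 and 𝒜𝒱(f) := (1/2)[𝔷, H](f/𝔷). Then 𝒜𝒱(ε) = 0, i.e. [𝔷, H]( (|𝔷|² − 1)/𝔷 ) = 0 identically. -/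

import Mathlib

open MeasureTheory Filter Set
open scoped Real Topology

noncomputable section

/-- `g` is the principal-value Hilbert transform of `f` along the closed curve
parametrized by `z` (2π-periodic parametrization). -/
def IsPV (z f g : ℝ → ℂ) : Prop :=
  ∀ α : ℝ, Tendsto (fun ρ : ℝ =>
      ((Real.pi : ℂ) * Complex.I)⁻¹ *
        ∫ β in {β : ℝ | ρ < |β - α| ∧ |β - α| ≤ Real.pi},
          f β * deriv z β / (z β - z α))
    (𝓝[>] (0:ℝ)) (𝓝 (g α))

/-- `H` is the Hilbert transform associated to the curve `z`, acting on smooth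
2π-periodic functions. -/
def IsHT (z : ℝ → ℂ) (H : (ℝ → ℂ) → ℝ → ℂ) : Prop :=
  ∀ f : ℝ → ℂ, ContDiff ℝ (⊤ : ℕ∞) f → (∀ α, f (α + 2*Real.pi) = f α) → IsPV z f (H f)

/-- `z` is a smooth regular 2π-periodic parametrization of a simple closed curve. -/
def IsClosedCurve (z : ℝ → ℂ) : Prop :=
  ContDiff ℝ (⊤ : ℕ∞) z ∧ (∀ α, z (α + 2*Real.pi) = z α) ∧ (∀ α, deriv z α ≠ 0) ∧
    Set.InjOn z (Set.Ico 0 (2*Real.pi))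

/-- The commutator `[f, H]g := f·(Hg) − H(f·g)`. -/
def commH (H : (ℝ → ℂ) → ℝ → ℂ) (f g : ℝ → ℂ) (α : ℝ) : ℂ :=
  f α * H g α - H (fun β => f β * g β) α

/-- The contour integral `∫ dz / (z - w)` over one period, that is `2πi` times the winding
number of the curve about `w`. -/
def windingIntegral (z : ℝ → ℂ) (w : ℂ) : ℂ :=
  ∫ β in (0:ℝ)..(2 * π), deriv z β / (z β - w)

lemma IsClosedCurve.hasDerivAt {z : ℝ → ℂ} (hz : IsClosedCurve z) (α : ℝ) :
    HasDerivAt z (deriv z α) α :=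
  (hz.1.differentiable (by simp) α).hasDerivAt

lemma IsClosedCurve.continuous_deriv {z : ℝ → ℂ} (hz : IsClosedCurve z) :
    Continuous (deriv z) :=
  hz.1.continuous_deriv (by simp)

lemma IsClosedCurve.continuous_cauchyKernel {z : ℝ → ℂ} (hz : IsClosedCurve z) {w : ℂ}
    (hw : w ∉ range z) : Continuous fun β => deriv z β / (z β - w) :=
  hz.continuous_deriv.div (hz.1.continuous.sub continuous_const)
    fun β h => hw ⟨β, sub_eq_zero.1 h⟩

lemma IsClosedCurve.apply_two_pi {z : ℝ → ℂ} (hz : IsClosedCurve z) : z (2 * π) = z 0 := by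
  simpa using hz.2.1 0

lemma IsClosedCurve.range_eq {z : ℝ → ℂ} (hz : IsClosedCurve z) (a : ℝ) :
    range z = z '' Ico a (a + 2 * π) := by
  have hp : Function.Periodic z (2 * π) := hz.2.1
  refine Subset.antisymm ?_ (image_subset_range _ _)
  rintro _ ⟨β, rfl⟩
  obtain ⟨y, hy, hxy⟩ := hp.exists_mem_Ico (c := 2 * π) (by positivity) β a
  exact ⟨y, hy, hxy.symm⟩

lemma IsClosedCurve.isCompact_range {z : ℝ → ℂ} (hz : IsClosedCurve z) :
    IsCompact (range z) := by
  have : range z = z '' Icc 0 (0 + 2 * π) :=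
    Subset.antisymm ((hz.range_eq 0).trans_subset (image_mono Ico_subset_Icc_self))
      (image_subset_range _ _)
  rw [this]
  exact isCompact_Icc.image hz.1.continuous

lemma windingIntegral_eq_of_norm_lt {z : ℝ → ℂ} (hz : IsClosedCurve z) {w w' : ℂ}
    (h : ∀ β, ‖w - w'‖ < ‖z β - w'‖) : windingIntegral z w = windingIntegral z w' := by
  have hw' : w' ∉ range z := by
    rintro ⟨β, hβ⟩
    have := (norm_nonneg _).trans_lt (h β)
    simp [hβ] at this
  have hw : w ∉ range z := by
    rintro ⟨β, hβ⟩
    have := h β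
    simp [hβ] at this
  have hd' : ∀ β, z β - w' ≠ 0 := fun β h => hw' ⟨β, sub_eq_zero.1 h⟩
  have hd : ∀ β, z β - w ≠ 0 := fun β h => hw ⟨β, sub_eq_zero.1 h⟩
  have hs : ∀ β, (z β - w) / (z β - w') ∈ Complex.slitPlane := by
    intro β
    have e : (z β - w) / (z β - w') = 1 + (-((w - w') / (z β - w'))) := by
      field_simp [hd' β]
      ring
    rw [e]
    apply Complex.mem_slitPlane_of_norm_lt_one
    rw [norm_neg, norm_div, div_lt_one (norm_pos_iff.2 (hd' β))]
    exact h β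
  have key : ∀ β, HasDerivAt (fun β => Complex.log ((z β - w) / (z β - w')))
      (deriv z β / (z β - w) - deriv z β / (z β - w')) β := by
    intro β
    have h1 : HasDerivAt (fun β => (z β - w) / (z β - w')) _ β :=
      ((hz.hasDerivAt β).sub_const w).div ((hz.hasDerivAt β).sub_const w') (hd' β)
    have h2 := h1.clog_real (hs β)
    convert h2 using 1
    have := hd β
    have := hd' β
    field_simp
  have hI := intervalIntegral.integral_eq_sub_of_hasDerivAt (a := 0) (b := 2 * π)
    (fun β _ => key β) (((hz.continuous_cauchyKernel hw).sub
      (hz.continuous_cauchyKernel hw')).intervalIntegrable _ _)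
  rw [intervalIntegral.integral_sub
    ((hz.continuous_cauchyKernel hw).intervalIntegrable _ _)
    ((hz.continuous_cauchyKernel hw').intervalIntegrable _ _), hz.apply_two_pi, sub_self] at hI
  exact sub_eq_zero.1 hI

lemma windingIntegral_eq_zero_of_norm_lt {z : ℝ → ℂ} (hz : IsClosedCurve z) {w : ℂ}
    (h : ∀ β, ‖z β‖ < ‖w‖) : windingIntegral z w = 0 := by
  have hw0 : w ≠ 0 := norm_pos_iff.1 ((norm_nonneg _).trans_lt (h 0))
  have hw : w ∉ range z := by
    rintro ⟨β, hβ⟩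
    have := h β
    simp [hβ] at this
  have hd : ∀ β, z β - w ≠ 0 := fun β h => hw ⟨β, sub_eq_zero.1 h⟩
  have hs : ∀ β, (z β - w) / (-w) ∈ Complex.slitPlane := by
    intro β
    have e : (z β - w) / (-w) = 1 + (-(z β / w)) := by
      field_simp
      ring
    rw [e]
    apply Complex.mem_slitPlane_of_norm_lt_one
    rw [norm_neg, norm_div, div_lt_one (norm_pos_iff.2 hw0)]
    exact h β
  have key : ∀ β, HasDerivAt (fun β => Complex.log ((z β - w) / (-w)))
      (deriv z β / (z β - w)) β := by
    intro β
    have h2 := (((hz.hasDerivAt β).sub_const w).div_const (-w)).clog_real (hs β)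
    convert h2 using 1
    have := hd β
    field_simp
  have hI := intervalIntegral.integral_eq_sub_of_hasDerivAt (a := 0) (b := 2 * π)
    (fun β _ => key β) ((hz.continuous_cauchyKernel hw).intervalIntegrable _ _)
  rw [hz.apply_two_pi, sub_self] at hI
  exact hI

lemma windingIntegral_eventually_eq {z : ℝ → ℂ} (hz : IsClosedCurve z) {w : ℂ}
    (hw : w ∉ range z) : ∀ᶠ w' in 𝓝 w, windingIntegral z w' = windingIntegral z w := by
  obtain ⟨r, hr, hr'⟩ := Metric.isOpen_iff.1 hz.isCompact_range.isClosed.isOpen_compl w hw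
  filter_upwards [Metric.ball_mem_nhds w hr] with w' hw'
  refine windingIntegral_eq_of_norm_lt hz fun β => ?_
  rw [mem_ball_iff_norm] at hw'
  by_contra! hlt
  exact hr' (mem_ball_iff_norm.2 (hlt.trans_lt hw')) ⟨β, rfl⟩

lemma windingIntegral_eq_of_isPreconnected {z : ℝ → ℂ} (hz : IsClosedCurve z) {s : Set ℂ}
    (hs : IsPreconnected s) (hd : Disjoint s (range z)) {w w' : ℂ} (hw : w ∈ s) (hw' : w' ∈ s) :
    windingIntegral z w = windingIntegral z w' := by
  have := isPreconnected_iff_preconnectedSpace.1 hs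
  have hl : IsLocallyConstant (fun x : s => windingIntegral z x) := by
    rw [IsLocallyConstant.iff_eventually_eq]
    exact fun x => continuousAt_subtype_val.eventually
      (windingIntegral_eventually_eq hz (disjoint_left.1 hd x.2))
  exact hl.apply_eq_of_preconnectedSpace ⟨w, hw⟩ ⟨w', hw'⟩

/-- If `e^L = conj z · e^{ik}` with `L` periodic and `k` of degree one, then `z` winds once
around the origin. -/
lemma windingIntegral_zero_of_exp_eq {z L : ℝ → ℂ} {k : ℝ → ℝ} (hz : IsClosedCurve z)
    (h0 : (0:ℂ) ∉ range z) (hk : ContDiff ℝ 1 k) (hkper : k (2 * π) = k 0 + 2 * π)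
    (hL : ContDiff ℝ 1 L) (hLper : L (2 * π) = L 0)
    (hexp : ∀ α, Complex.exp (L α)
      = (starRingEnd ℂ) (z α) * Complex.exp (Complex.I * (k α : ℂ))) :
    windingIntegral z 0 = 2 * π * Complex.I := by
  have hz0 : ∀ α, z α ≠ 0 := fun α h => h0 ⟨α, h⟩
  have hdk : ∀ α, HasDerivAt (fun α => (k α : ℂ)) ((deriv k α : ℝ) : ℂ) α := fun α =>
    (hk.differentiable (by simp) α).hasDerivAt.ofReal_comp
  have hdL : ∀ α, HasDerivAt L (deriv L α) α := fun α =>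
    (hL.differentiable (by simp) α).hasDerivAt
  have hdz : ∀ α, HasDerivAt (fun α => (starRingEnd ℂ) (z α)) ((starRingEnd ℂ) (deriv z α)) α :=
    fun α => (hz.hasDerivAt α).star
  have hder : ∀ α, deriv L α
      = (starRingEnd ℂ) (deriv z α / (z α - 0)) + Complex.I * ((deriv k α : ℝ) : ℂ) := by
    intro α
    have h1 := (hdL α).cexp
    have h2 := (hdz α).mul ((hdk α).const_mul Complex.I).cexp
    have h3 := h1.unique (h2.congr_of_eventuallyEq (Eventually.of_forall hexp))
    have hc : (starRingEnd ℂ) (z α) ≠ 0 := by simpa using hz0 α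
    have he := Complex.exp_ne_zero (Complex.I * (k α : ℂ))
    rw [hexp α] at h3
    rw [sub_zero, map_div₀]
    apply mul_left_cancel₀ (mul_ne_zero hc he)
    rw [h3]
    field_simp
  have hI1 : ∫ β in (0:ℝ)..(2 * π), deriv L β = 0 := by
    rw [intervalIntegral.integral_eq_sub_of_hasDerivAt (fun β _ => hdL β)
      ((hL.continuous_deriv le_rfl).intervalIntegrable _ _), hLper, sub_self]
  have hck : Continuous fun α => ((deriv k α : ℝ) : ℂ) :=
    Complex.continuous_ofReal.comp (hk.continuous_deriv le_rfl)
  have hck' : Continuous fun α => Complex.I * ((deriv k α : ℝ) : ℂ) := continuous_const.mul hck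
  have hI2 : ∫ β in (0:ℝ)..(2 * π), ((deriv k β : ℝ) : ℂ) = 2 * π := by
    rw [intervalIntegral.integral_eq_sub_of_hasDerivAt (fun β _ => hdk β)
      (hck.intervalIntegrable _ _), hkper]
    push_cast
    ring
  have hcont : Continuous fun β => (starRingEnd ℂ) (deriv z β / (z β - 0)) :=
    Complex.continuous_conj.comp (hz.continuous_cauchyKernel h0)
  have hI3 : ∫ β in (0:ℝ)..(2 * π), (starRingEnd ℂ) (deriv z β / (z β - 0))
      = (starRingEnd ℂ) (windingIntegral z 0) := by
    simp only [windingIntegral, intervalIntegral.integral_of_le Real.two_pi_pos.le]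
    exact integral_conj
  simp only [hder] at hI1
  rw [intervalIntegral.integral_add (hcont.intervalIntegrable _ _)
    (hck'.intervalIntegrable _ _), hI3,
    intervalIntegral.integral_const_mul, hI2] at hI1
  have := congrArg (starRingEnd ℂ) hI1
  simp [map_ofNat] at this
  linear_combination this

lemma IsClosedCurve.eq_of_abs_sub_lt {z : ℝ → ℂ} (hz : IsClosedCurve z) {x y : ℝ}
    (h : z x = z y) (hxy : |x - y| < 2 * π) : x = y := by
  have hp : Function.Periodic z (2 * π) := hz.2.1
  obtain ⟨m, hm, -⟩ := existsUnique_add_zsmul_mem_Ico Real.two_pi_pos x 0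
  obtain ⟨n, hn, -⟩ := existsUnique_add_zsmul_mem_Ico Real.two_pi_pos y 0
  rw [zero_add] at hm hn
  have he := hz.2.2.2 hm hn (by rw [hp.zsmul m x, hp.zsmul n y, h])
  simp only [zsmul_eq_mul] at he
  have hxy' : x - y = ((n - m : ℤ) : ℝ) * (2 * π) := by
    push_cast
    linarith
  rw [hxy', abs_mul, abs_of_pos Real.two_pi_pos] at hxy
  have h1 : |((n - m : ℤ) : ℝ)| < 1 := by
    by_contra! hge
    nlinarith [Real.two_pi_pos]
  have h2 : n - m = 0 := by
    rw [← Int.cast_abs] at h1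
    exact Int.abs_lt_one_iff.1 (by exact_mod_cast h1)
  rw [h2] at hxy'
  simp at hxy'
  linarith

/-- Normal coordinates along the curve `z`: the point at signed distance proportional to `p.2`
from `z p.1`. -/
def normalCoord (z : ℝ → ℂ) (p : ℝ × ℝ) : ℂ := z p.1 + p.2 * (Complex.I * deriv z p.1)

lemma normalCoord_zero (z : ℝ → ℂ) (a : ℝ) : normalCoord z (a, 0) = z a := by
  simp [normalCoord]

lemma IsClosedCurve.contDiff_deriv {z : ℝ → ℂ} (hz : IsClosedCurve z) :
    ContDiff ℝ (⊤ : ℕ∞) (deriv z) :=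
  (contDiff_infty_iff_deriv.1 hz.1).2

lemma IsClosedCurve.contDiff_normalCoord {z : ℝ → ℂ} (hz : IsClosedCurve z) :
    ContDiff ℝ (⊤ : ℕ∞) (normalCoord z) := by
  unfold normalCoord
  exact (hz.1.comp contDiff_fst).add ((Complex.ofRealCLM.contDiff.comp contDiff_snd).mul
    (contDiff_const.mul (hz.contDiff_deriv.comp contDiff_fst)))

lemma IsClosedCurve.exists_equiv_hasFDerivAt_normalCoord {z : ℝ → ℂ} (hz : IsClosedCurve z)
    (a : ℝ) :
    ∃ A : (ℝ × ℝ) ≃L[ℝ] ℂ, HasFDerivAt (normalCoord z) (A : ℝ × ℝ →L[ℝ] ℂ) (a, 0) := by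
  refine ⟨Complex.equivRealProdCLM.symm.trans
    (ContinuousLinearEquiv.smulLeft (Units.mk0 (deriv z a) (hz.2.2.1 a))), ?_⟩
  have h1 : HasFDerivAt (fun p : ℝ × ℝ => z p.1) _ (a, 0) :=
    (hz.hasDerivAt a).hasFDerivAt.comp (a, (0:ℝ)) hasFDerivAt_fst
  have hz' : HasDerivAt (deriv z) (deriv (deriv z) a) a :=
    (hz.contDiff_deriv.differentiable (by simp) a).hasDerivAt
  have h2 : HasFDerivAt (fun p : ℝ × ℝ => Complex.I * deriv z p.1) _ (a, 0) :=
    HasFDerivAt.comp (g := fun x => Complex.I * deriv z x) (a, (0:ℝ))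
      (hz'.const_mul Complex.I).hasFDerivAt hasFDerivAt_fst
  have h3 : HasFDerivAt (fun p : ℝ × ℝ => (p.2 : ℂ)) _ (a, 0) :=
    Complex.ofRealCLM.hasFDerivAt.comp (a, (0:ℝ)) hasFDerivAt_snd
  refine (h1.add (h3.mul h2)).congr_fderiv ?_
  ext <;> simp [Units.smul_def, Complex.equivRealProdCLM_symm_apply]
  ring

lemma IsClosedCurve.exists_box {z : ℝ → ℂ} (hz : IsClosedCurve z) (a : ℝ) :
    ∃ r > 0, IsOpen (normalCoord z '' (Metric.ball a r ×ˢ Metric.ball 0 r)) ∧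
      ∀ p ∈ Metric.ball a r ×ˢ Metric.ball 0 r, p.2 ≠ 0 → normalCoord z p ∉ range z := by
  have hcd : ContDiffAt ℝ (⊤ : ℕ∞) (normalCoord z) (a, 0) := hz.contDiff_normalCoord.contDiffAt
  obtain ⟨A, hA⟩ := hz.exists_equiv_hasFDerivAt_normalCoord a
  set e := hcd.toOpenPartialHomeomorph _ hA (by simp) with he
  have hec : (e : ℝ × ℝ → ℂ) = normalCoord z :=
    hcd.toOpenPartialHomeomorph_coe hA (by simp)
  have hmem : (a, (0:ℝ)) ∈ e.source :=
    hcd.mem_toOpenPartialHomeomorph_source hA (by simp)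
  obtain ⟨r₀, hr₀, hr₀s⟩ := Metric.isOpen_iff.1 e.open_source _ hmem
  set r₁ := min r₀ π with hr₁
  have hr₁0 : 0 < r₁ := lt_min hr₀ Real.pi_pos
  have hr₁π : r₁ ≤ π := min_le_right _ _
  have hK : IsClosed (z '' Icc (a + r₁) (a + 2 * π - r₁)) :=
    (isCompact_Icc.image hz.1.continuous).isClosed
  have hzK : normalCoord z (a, 0) ∈ (z '' Icc (a + r₁) (a + 2 * π - r₁))ᶜ := by
    rw [normalCoord_zero]
    rintro ⟨β, ⟨hβ1, hβ2⟩, hβ⟩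
    have := hz.eq_of_abs_sub_lt hβ (by rw [abs_lt]; constructor <;> linarith)
    linarith
  obtain ⟨r₂, hr₂, hr₂s⟩ := Metric.isOpen_iff.1
    (hK.isOpen_compl.preimage hz.contDiff_normalCoord.continuous) _ hzK
  have hbox : Metric.ball a (min r₁ r₂) ×ˢ Metric.ball 0 (min r₁ r₂) ⊆ e.source := by
    rw [ball_prod_same]
    exact (Metric.ball_subset_ball ((min_le_left _ _).trans (min_le_left _ _))).trans hr₀s
  refine ⟨min r₁ r₂, lt_min hr₁0 hr₂, ?_, ?_⟩
  · rw [← hec]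
    refine e.isOpen_image_of_subset_source ?_ hbox
    exact Metric.isOpen_ball.prod Metric.isOpen_ball
  · intro p hp hp2 hpz
    have hpK : normalCoord z p ∉ z '' Icc (a + r₁) (a + 2 * π - r₁) := by
      apply hr₂s
      rw [ball_prod_same] at hp
      exact Metric.ball_subset_ball (min_le_right _ _) hp
    rw [hz.range_eq (a - r₁)] at hpz
    obtain ⟨β, ⟨hβ1, hβ2⟩, hβ⟩ := hpz
    rcases hβ1.eq_or_lt with h | h
    · refine hpK ⟨a + 2 * π - r₁, ⟨by linarith, le_rfl⟩, ?_⟩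
      rw [← hβ, ← h, ← hz.2.1 (a - r₁)]
      congr 1
      ring
    · rcases lt_or_ge β (a + r₁) with h' | h'
      · have hβs : (β, (0:ℝ)) ∈ e.source := by
          apply hr₀s
          rw [← ball_prod_same]
          refine ⟨?_, Metric.mem_ball_self hr₀⟩
          rw [Metric.mem_ball, Real.dist_eq, abs_lt]
          have : r₁ ≤ r₀ := min_le_left _ _
          constructor <;> linarith
        have := e.injOn (hbox hp) hβs (by rw [hec, normalCoord_zero, hβ])
        exact hp2 (by rw [this])
      · exact hpK ⟨β, ⟨h', by linarith⟩, hβ⟩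

lemma IsClosedCurve.exists_sides {z : ℝ → ℂ} (hz : IsClosedCurve z) :
    ∃ c d : ℂ, ∀ a : ℝ, ∃ r > 0,
      IsOpen (normalCoord z '' (Metric.ball a r ×ˢ Metric.ball 0 r)) ∧
      (∀ p ∈ Metric.ball a r ×ˢ Metric.ball 0 r, p.2 ≠ 0 → normalCoord z p ∉ range z) ∧
      (∀ p ∈ Metric.ball a r ×ˢ Metric.ball 0 r, 0 < p.2 →
        windingIntegral z (normalCoord z p) = c) ∧
      (∀ p ∈ Metric.ball a r ×ˢ Metric.ball 0 r, p.2 < 0 →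
        windingIntegral z (normalCoord z p) = d) := by
  choose r hr hopen hdisj using hz.exists_box
  have hmem : ∀ a s, |s| < r a → (a, s) ∈ Metric.ball a (r a) ×ˢ Metric.ball 0 (r a) :=
    fun a s hs => ⟨Metric.mem_ball_self (hr a), by simpa using hs⟩
  have hside : ∀ a, ∀ p ∈ Metric.ball a (r a) ×ˢ Metric.ball (0:ℝ) (r a),
      ∀ q ∈ Metric.ball a (r a) ×ˢ Metric.ball (0:ℝ) (r a), 0 < p.2 * q.2 →
      windingIntegral z (normalCoord z p) = windingIntegral z (normalCoord z q) := by
    intro a p hp q hq hpq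
    have hconv : Convex ℝ (Metric.ball a (r a) ×ˢ Metric.ball (0:ℝ) (r a)) :=
      (convex_ball _ _).prod (convex_ball _ _)
    have hseg : ∀ x ∈ segment ℝ p q, x.2 ≠ 0 := by
      rintro x ⟨s, t, hs, ht, hst, rfl⟩ h0
      simp only [Prod.snd_add, Prod.smul_snd, smul_eq_mul] at h0
      have h1 : s * (p.2 * p.2) + t * (p.2 * q.2) = 0 := by linear_combination p.2 * h0
      have h2 : 0 < p.2 * p.2 := mul_self_pos.2 (left_ne_zero_of_mul hpq.ne')
      rcases hs.eq_or_lt with h | h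
      · subst h
        simp only [zero_add] at hst
        subst hst
        linarith
      · nlinarith [mul_pos h h2, mul_nonneg ht hpq.le]
    refine windingIntegral_eq_of_isPreconnected hz
      ((convex_segment p q).isPreconnected.image _
        hz.contDiff_normalCoord.continuous.continuousOn) ?_
      ⟨p, left_mem_segment ℝ p q, rfl⟩ ⟨q, right_mem_segment ℝ p q, rfl⟩
    rw [disjoint_left]
    rintro _ ⟨x, hx, rfl⟩
    exact hdisj a x (hconv.segment_subset hp hq hx) (hseg x hx)
  have key : ∀ σ : ℝ, |σ| = 1 → ∀ a, windingIntegral z (normalCoord z (a, σ * (r a / 2)))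
      = windingIntegral z (normalCoord z (0, σ * (r 0 / 2))) := by
    intro σ hσ
    have hσ2 : 0 < σ * σ := mul_self_pos.2 (by rintro rfl; simp at hσ)
    have hl : IsLocallyConstant fun a =>
        windingIntegral z (normalCoord z (a, σ * (r a / 2))) := by
      rw [IsLocallyConstant.iff_eventually_eq]
      intro a
      filter_upwards [Metric.ball_mem_nhds a (hr a)] with b hb
      have ha := hr a
      have hb' := hr b
      set s := min (r a) (r b) / 2 with hs
      have hs0 : 0 < s := half_pos (lt_min ha hb')
      have hsa : s < r a := by
        have := min_le_left (r a) (r b)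
        linarith
      have hsb : s < r b := by
        have := min_le_right (r a) (r b)
        linarith
      have e1 := hside b (b, σ * (r b / 2)) (hmem _ _ (by
        rw [abs_mul, hσ, abs_of_pos (by linarith)]; linarith)) (b, σ * s) (hmem _ _ (by
        rw [abs_mul, hσ, abs_of_pos (by linarith)]; linarith)) (by
        have : 0 < σ * σ * (r b / 2 * s) := by positivity
        simp only
        linarith)
      have e2 := hside a (a, σ * (r a / 2)) (hmem _ _ (by
        rw [abs_mul, hσ, abs_of_pos (by linarith)]; linarith)) (b, σ * s) ⟨hb, by
        rw [mem_ball_zero_iff, Real.norm_eq_abs, abs_mul, hσ, abs_of_pos (by linarith)]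
        linarith⟩ (by
        have : 0 < σ * σ * (r a / 2 * s) := by positivity
        simp only
        linarith)
      rw [e1, e2]
    exact fun a => hl.apply_eq_of_preconnectedSpace a 0
  refine ⟨windingIntegral z (normalCoord z (0, 1 * (r 0 / 2))),
    windingIntegral z (normalCoord z (0, -1 * (r 0 / 2))), fun a =>
    ⟨r a, hr a, hopen a, hdisj a, fun p hp hp2 => ?_, fun p hp hp2 => ?_⟩⟩
  · rw [← key 1 (by simp) a]
    have := hr a
    exact hside a p hp _ (hmem _ _ (by rw [abs_of_pos] <;> linarith)) (by simp; positivity)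
  · rw [← key (-1) (by simp) a]
    have := hr a
    exact hside a p hp _ (hmem _ _ (by rw [abs_of_neg] <;> linarith)) (by
      simp only
      nlinarith)

lemma eq_empty_of_locally {z : ℝ → ℂ} {T : Set ℂ}
    (hT : ∀ w ∈ T, ∀ᶠ w' in 𝓝 w, w' ∈ T) (hTc : ∀ w ∉ range z, w ∉ T → ∀ᶠ w' in 𝓝 w, w' ∉ T)
    (hTz : ∀ a, ∀ᶠ w in 𝓝 (z a), w ∉ T) : T = ∅ := by
  have hcl : IsClopen T := by
    refine ⟨isOpen_compl_iff.1 (isOpen_iff_mem_nhds.2 fun w hw => ?_), isOpen_iff_mem_nhds.2 hT⟩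
    by_cases h : w ∈ range z
    · obtain ⟨a, rfl⟩ := h
      exact hTz a
    · exact hTc w h hw
  rcases isClopen_iff.1 hcl with h | h
  · exact h
  · have := (hTz 0).self_of_nhds
    simp [h] at this

lemma IsPreconnected.subset_of_disjoint_frontier {X : Type*} [TopologicalSpace X] {s u : Set X}
    (hs : IsPreconnected s) (hu : IsOpen u) (hd : Disjoint s (frontier u))
    (h : (s ∩ u).Nonempty) : s ⊆ u := by
  refine hs.subset_left_of_subset_union hu isClosed_closure.isOpen_compl
    (disjoint_compl_right.mono_left subset_closure) (fun x hx => ?_) h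
  by_contra! hn
  simp only [mem_union, mem_compl_iff, not_or, not_not] at hn
  exact disjoint_left.1 hd hx (by rw [hu.frontier_eq]; exact ⟨hn.2, hn.1⟩)

/-- A smooth closed curve winding nontrivially about a point of a domain bounded by it does not
wind about any point outside that domain. -/
lemma windingIntegral_eq_zero_of_notMem {z : ℝ → ℂ} (hz : IsClosedCurve z) {Ω : Set ℂ}
    (hΩ : IsOpen Ω) (hconn : IsPreconnected Ω) (hfr : frontier Ω = range z) {w₀ : ℂ}
    (hw₀ : w₀ ∈ Ω) (hne : windingIntegral z w₀ ≠ 0) {w : ℂ} (hw : w ∉ Ω) (hwz : w ∉ range z) :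
    windingIntegral z w = 0 := by
  have hdΩ : Disjoint Ω (range z) := by
    rw [← hfr, disjoint_comm]
    exact disjoint_frontier_iff_isOpen.2 hΩ
  have hWΩ : ∀ w ∈ Ω, windingIntegral z w = windingIntegral z w₀ := fun w hw =>
    windingIntegral_eq_of_isPreconnected hz hconn hdΩ hw hw₀
  set v := windingIntegral z w₀ with hv
  obtain ⟨c, d, hcd⟩ := hz.exists_sides
  have hnear : ∀ a, ∀ r > 0, IsOpen (normalCoord z '' (Metric.ball a r ×ˢ Metric.ball 0 r)) →
      normalCoord z '' (Metric.ball a r ×ˢ Metric.ball 0 r) ∈ 𝓝 (z a) := fun a r hr ho =>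
    ho.mem_nhds ⟨(a, 0), ⟨Metric.mem_ball_self hr, Metric.mem_ball_self hr⟩, normalCoord_zero z a⟩
  have hax : ∀ p : ℝ × ℝ, p.2 = 0 → normalCoord z p ∈ range z := fun p hp =>
    ⟨p.1, by simp [normalCoord, hp]⟩
  have hvals : ∀ w ∉ range z, windingIntegral z w = c ∨ windingIntegral z w = d := by
    have h1 : {w | w ∉ range z ∧ windingIntegral z w ≠ c ∧ windingIntegral z w ≠ d} = ∅ := by
      refine eq_empty_of_locally (z := z) ?_ ?_ ?_
      · rintro w ⟨hw, hw'⟩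
        filter_upwards [windingIntegral_eventually_eq hz hw,
          hz.isCompact_range.isClosed.isOpen_compl.mem_nhds hw] with w' h h'
        exact ⟨h', by rwa [h]⟩
      · intro w hw hwT
        filter_upwards [windingIntegral_eventually_eq hz hw] with w' h h'
        exact hwT ⟨hw, by rw [← h]; exact h'.2⟩
      · intro a
        obtain ⟨r, hr, ho, -, hc, hd⟩ := hcd a
        filter_upwards [hnear a r hr ho]
        rintro _ ⟨p, hp, rfl⟩ ⟨hpz, hpc, hpd⟩
        rcases lt_trichotomy p.2 0 with h | h | h
        · exact hpd (hd p hp h)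
        · exact hpz (hax p h)
        · exact hpc (hc p hp h)
    intro w hw
    by_contra! hcon
    exact notMem_empty w (h1 ▸ ⟨hw, hcon⟩)
  have h0 : (0:ℂ) = c ∨ 0 = d := by
    obtain ⟨R, hR⟩ := hz.isCompact_range.isBounded.exists_norm_le
    have hlt : ∀ β, ‖z β‖ < ‖((|R| + 1 : ℝ) : ℂ)‖ := by
      intro β
      rw [Complex.norm_real, Real.norm_eq_abs, abs_of_pos (by positivity)]
      linarith [hR _ ⟨β, rfl⟩, le_abs_self R]
    rw [← windingIntegral_eq_zero_of_norm_lt hz hlt]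
    refine hvals _ ?_
    rintro ⟨β, hβ⟩
    exact (hβ ▸ hlt β).false
  have hv' : v = c ∨ v = d := hvals _ (disjoint_left.1 hdΩ hw₀)
  have h2 : {w | w ∉ range z ∧ w ∉ Ω ∧ windingIntegral z w = v} = ∅ := by
    refine eq_empty_of_locally (z := z) ?_ ?_ ?_
    · rintro w ⟨hw, hwΩ, hw'⟩
      have : w ∉ closure Ω := by
        rw [closure_eq_self_union_frontier, hfr]
        simp [hwΩ, hw]
      filter_upwards [windingIntegral_eventually_eq hz hw,
        hz.isCompact_range.isClosed.isOpen_compl.mem_nhds hw,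
        isClosed_closure.isOpen_compl.mem_nhds this] with w' h h' h''
      exact ⟨h', fun hc => h'' (subset_closure hc), by rwa [h]⟩
    · intro w hw hwT
      by_cases hwΩ : w ∈ Ω
      · filter_upwards [hΩ.mem_nhds hwΩ] with w' h h'
        exact h'.2.1 h
      · filter_upwards [windingIntegral_eventually_eq hz hw] with w' h h'
        exact hwT ⟨hw, hwΩ, by rw [← h]; exact h'.2.2⟩
    · intro a
      obtain ⟨r, hr, ho, hdis, hc, hd⟩ := hcd a
      have hcl : z a ∈ closure Ω := frontier_subset_closure (hfr ▸ ⟨a, rfl⟩)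
      obtain ⟨_, ⟨q, hq, rfl⟩, hqΩ⟩ := mem_closure_iff_nhds.1 hcl _ (hnear a r hr ho)
      have hsub : ∀ s ⊆ Metric.ball 0 r, (∀ x ∈ s, x ≠ 0) → Convex ℝ s → q.2 ∈ s →
          ∀ p ∈ Metric.ball a r ×ˢ Metric.ball 0 r, p.2 ∈ s → normalCoord z p ∈ Ω := by
        intro s hs hs0 hsc hqs p hp hps
        have hpre : IsPreconnected (normalCoord z '' (Metric.ball a r ×ˢ s)) :=
          ((convex_ball a r).prod hsc).isPreconnected.image _
            hz.contDiff_normalCoord.continuous.continuousOn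
        refine hpre.subset_of_disjoint_frontier hΩ ?_
          ⟨normalCoord z q, ⟨q, ⟨hq.1, hqs⟩, rfl⟩, hqΩ⟩ ⟨p, ⟨hp.1, hps⟩, rfl⟩
        rw [hfr, disjoint_left]
        rintro _ ⟨x, hx, rfl⟩
        exact hdis x ⟨hx.1, hs hx.2⟩ (hs0 _ hx.2)
      filter_upwards [hnear a r hr ho]
      rintro _ ⟨p, hp, rfl⟩ ⟨hpz, hpΩ, hpv⟩
      have hp0 : p.2 ≠ 0 := fun h => hpz (hax p h)
      have hball : ∀ x ∈ Metric.ball (0:ℝ) r, -r < x ∧ x < r := fun x hx => by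
        rwa [mem_ball_zero_iff, Real.norm_eq_abs, abs_lt] at hx
      rcases lt_trichotomy q.2 0 with h | h | h
      · have hvd : v = d := by rw [← hWΩ _ hqΩ, hd q hq h]
        rcases lt_or_gt_of_ne hp0 with h' | h'
        · exact hpΩ (hsub (Ioo (-r) 0) (fun x hx => by
            rw [mem_ball_zero_iff, Real.norm_eq_abs, abs_lt]; exact ⟨hx.1, hx.2.trans hr⟩)
            (fun x hx => hx.2.ne) (convex_Ioo _ _) ⟨(hball _ hq.2).1, h⟩ p hp
            ⟨(hball _ hp.2).1, h'⟩)
        · have hvc : v = c := by rw [← hpv, hc p hp h']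
          rcases h0 with h0 | h0
          · exact hne (by rw [hvc, h0])
          · exact hne (by rw [hvd, h0])
      · exact disjoint_left.1 hdΩ hqΩ (hax q h)
      · have hvc : v = c := by rw [← hWΩ _ hqΩ, hc q hq h]
        rcases lt_or_gt_of_ne hp0 with h' | h'
        · have hvd : v = d := by rw [← hpv, hd p hp h']
          rcases h0 with h0 | h0
          · exact hne (by rw [hvc, h0])
          · exact hne (by rw [hvd, h0])
        · exact hpΩ (hsub (Ioo 0 r) (fun x hx => by
            rw [mem_ball_zero_iff, Real.norm_eq_abs, abs_lt]; exact ⟨by linarith [hx.1], hx.2⟩)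
            (fun x hx => hx.1.ne') (convex_Ioo _ _) ⟨h, (hball _ hq.2).2⟩ p hp
            ⟨h', (hball _ hp.2).2⟩)
  have hwv : windingIntegral z w ≠ v := fun h => notMem_empty w (h2 ▸ ⟨hwz, hw, h⟩)
  rcases h0 with h0 | h0 <;> rcases hv' with h | h <;> rcases hvals w hwz with h' | h'
  · exact absurd (h.trans h0.symm) hne
  · exact absurd (h.trans h0.symm) hne
  · rw [h', h0]
  · exact absurd (h'.trans h.symm) hwv
  · exact absurd (h'.trans h.symm) hwv
  · rw [h', h0]
  · exact absurd (h.trans h0.symm) hne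
  · exact absurd (h.trans h0.symm) hne

lemma circleAverage_inv_sub_of_lt {ζ : ℂ} {ρ : ℝ} (hρ : 0 < ρ) (h : ρ < ‖ζ‖) :
    Real.circleAverage (fun w => (ζ - w)⁻¹) 0 ρ = ζ⁻¹ := by
  have hne : ∀ w ∈ Metric.closedBall (0:ℂ) ρ, ζ - w ≠ 0 := by
    intro w hw h0
    rw [mem_closedBall_zero_iff, ← sub_eq_zero.1 h0] at hw
    linarith
  have hd : DiffContOnCl ℂ (fun w => (ζ - w)⁻¹) (Metric.ball 0 |ρ|) := by
    rw [abs_of_pos hρ]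
    refine DifferentiableOn.diffContOnCl fun w hw => ?_
    rw [closure_ball _ hρ.ne'] at hw
    exact ((differentiableAt_const ζ).sub differentiableAt_id).inv
      (hne w hw) |>.differentiableWithinAt
  simpa using hd.circleAverage

lemma circleAverage_inv_sub_of_gt {ζ : ℂ} (hζ : ζ ≠ 0) {ρ : ℝ} (h : ‖ζ‖ < ρ) :
    Real.circleAverage (fun w => (ζ - w)⁻¹) 0 ρ = 0 := by
  have hρ : 0 < ρ := (norm_nonneg _).trans_lt h
  have hne : ∀ w ∈ Metric.sphere (0:ℂ) |ρ|, w - ζ ≠ 0 := by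
    intro w hw h0
    rw [mem_sphere_zero_iff_norm, sub_eq_zero.1 h0, abs_of_pos hρ] at hw
    linarith
  have h1 := (diffContOnCl_const (𝕜 := ℂ) (s := Metric.ball (0:ℂ) |ρ|)
    (c := (1:ℂ))).circleAverage_smul_div (w := ζ)
    (by rw [abs_of_pos hρ]; exact mem_ball_zero_iff.2 h)
  have hci : CircleIntegrable (fun w : ℂ => ((w - 0) / (w - ζ)) • (1:ℂ)) 0 ρ := by
    refine ContinuousOn.circleIntegrable' fun w hw => ?_
    exact (((continuousAt_id.sub continuousAt_const).div
      (continuousAt_id.sub continuousAt_const) (hne w hw)).smul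
        continuousAt_const).continuousWithinAt
  have h2 : EqOn (fun w => (ζ - w)⁻¹)
      (ζ⁻¹ • ((fun _ => (1:ℂ)) - fun w : ℂ => ((w - 0) / (w - ζ)) • (1:ℂ)))
      (Metric.sphere 0 |ρ|) := by
    intro w hw
    have h3 := hne w hw
    have h4 : ζ - w ≠ 0 := fun h => h3 (by linear_combination -h)
    simp only [Pi.smul_apply, Pi.sub_apply, smul_eq_mul, sub_zero, mul_one]
    field_simp
    ring
  rw [Real.circleAverage_congr_sphere h2, Real.circleAverage_smul,
    Real.circleAverage_sub (circleIntegrable_const _ _ _) hci, h1, Real.circleAverage_const]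
  simp

lemma integrableOn_inv_norm_ball (r : ℝ) :
    IntegrableOn (fun w : ℂ => ‖w‖⁻¹) (Metric.ball 0 r) := by
  refine (integrableOn_fun_norm_addHaar volume (f := fun y : ℝ => y⁻¹)).2 ?_
  have : IntegrableOn (fun _ : ℝ => (1:ℝ)) (Ioo 0 r) := by
    simp
  refine this.congr_fun (fun y hy => ?_) measurableSet_Ioo
  simp [mul_inv_cancel₀ hy.1.ne']

lemma preimage_sub_left_ball (ζ : ℂ) (r : ℝ) :
    (fun w : ℂ => ζ - w) ⁻¹' Metric.ball 0 r = Metric.ball ζ r := by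
  ext w
  simp [dist_eq_norm, norm_sub_rev]

lemma integrableOn_inv_norm_sub_ball (ζ : ℂ) (r : ℝ) :
    IntegrableOn (fun w : ℂ => ‖ζ - w‖⁻¹) (Metric.ball ζ r) := by
  rw [← preimage_sub_left_ball]
  exact ((Measure.measurePreserving_sub_left volume ζ).integrableOn_comp_preimage
    (MeasurableEquiv.subLeft ζ).measurableEmbedding).2 (integrableOn_inv_norm_ball r)

lemma setIntegral_inv_norm_sub_ball (ζ : ℂ) (r : ℝ) :
    ∫ w in Metric.ball ζ r, ‖ζ - w‖⁻¹ = ∫ w in Metric.ball (0:ℂ) r, ‖w‖⁻¹ := by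
  rw [← preimage_sub_left_ball]
  exact (Measure.measurePreserving_sub_left volume ζ).setIntegral_preimage_emb
    (MeasurableEquiv.subLeft ζ).measurableEmbedding (fun w : ℂ => ‖w‖⁻¹) _

lemma ball_subset_ball_two_mul {ζ : ℂ} {R : ℝ} (h : ‖ζ‖ < R) :
    Metric.ball (0:ℂ) R ⊆ Metric.ball ζ (2 * R) :=
  Metric.ball_subset_ball' (by rw [dist_zero_left]; linarith)

lemma integrableOn_inv_sub_ball {ζ : ℂ} {R : ℝ} (h : ‖ζ‖ < R) :
    IntegrableOn (fun w : ℂ => (ζ - w)⁻¹) (Metric.ball 0 R) := by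
  refine ((integrableOn_inv_norm_sub_ball ζ (2 * R)).mono_set
    (ball_subset_ball_two_mul h)).mono' ?_ ?_
  · exact (measurable_const.sub measurable_id).inv.aestronglyMeasurable
  · exact Eventually.of_forall fun w => by simp

/-- The Cauchy transform of a disk centred at the origin. -/
lemma setIntegral_inv_sub_ball {ζ : ℂ} (hζ : ζ ≠ 0) {R : ℝ} (h : ‖ζ‖ < R) :
    ∫ w in Metric.ball (0:ℂ) R, (ζ - w)⁻¹ = π * (starRingEnd ℂ) ζ := by
  set f : ℂ → ℂ := (Metric.ball (0:ℂ) R).indicator fun w => (ζ - w)⁻¹ with hf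
  have hfi : Integrable f :=
    (integrable_indicator_iff measurableSet_ball).2 (integrableOn_inv_sub_ball h)
  have hfm : Measurable f :=
    ((measurable_const.sub measurable_id).inv).indicator measurableSet_ball
  have hsymm : Measurable (Complex.polarCoord.symm : ℝ × ℝ → ℂ) := by
    have : (Complex.polarCoord.symm : ℝ × ℝ → ℂ)
        = fun p => (p.1 : ℂ) * (Real.cos p.2 + Real.sin p.2 * Complex.I) :=
      funext Complex.polarCoord_symm_apply
    rw [this]
    fun_prop
  have hGi : IntegrableOn (fun p : ℝ × ℝ => p.1 • f (Complex.polarCoord.symm p))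
      (Ioi 0 ×ˢ Ioo (-π) π) := by
    refine ⟨(measurable_fst.smul (hfm.comp hsymm)).aestronglyMeasurable, ?_⟩
    have h1 := Complex.lintegral_comp_polarCoord_symm fun w => ‖f w‖ₑ
    have h2 : ∫⁻ p in Ioi 0 ×ˢ Ioo (-π) π, ‖p.1 • f (Complex.polarCoord.symm p)‖ₑ
        = ∫⁻ w, ‖f w‖ₑ := by
      rw [← h1]
      refine setLIntegral_congr_fun (measurableSet_Ioi.prod measurableSet_Ioo) fun p hp => ?_
      have hp1 : (0:ℝ) < p.1 := hp.1
      simp only [enorm_smul, smul_eq_mul, Real.enorm_of_nonneg hp1.le]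
    rw [HasFiniteIntegral, h2]
    exact hfi.2
  have hinner : ∀ ρ : ℝ, 0 < ρ → ρ ≠ ‖ζ‖ →
      ∫ θ in Ioo (-π) π, ρ • f (Complex.polarCoord.symm (ρ, θ))
        = (Iio ‖ζ‖).indicator (fun ρ : ℝ => (ρ : ℂ) * (2 * π * ζ⁻¹)) ρ := by
    intro ρ hρ hne
    have hmap : ∀ θ, Complex.polarCoord.symm (ρ, θ) = circleMap 0 ρ θ := by
      intro θ
      rw [Complex.polarCoord_symm_apply, circleMap, zero_add, Complex.exp_mul_I]
      push_cast
      rfl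
    have hfmap : ∀ θ, f (circleMap 0 ρ θ)
        = if ρ < R then (ζ - circleMap 0 ρ θ)⁻¹ else 0 := by
      intro θ
      simp [hf, indicator, abs_of_pos hρ]
    rw [integral_smul]
    simp only [hmap, hfmap]
    by_cases hR : ρ < R
    · simp only [hR, if_true]
      have havg : ∫ θ in Ioo (-π) π, (ζ - circleMap 0 ρ θ)⁻¹
          = (2 * π) * Real.circleAverage (fun w => (ζ - w)⁻¹) 0 ρ := by
        rw [Real.circleAverage_eq_integral_add (-π),
          intervalIntegral.integral_comp_add_right (fun θ => (ζ - circleMap 0 ρ θ)⁻¹) (-π),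
          show 0 + -π = -π by ring, show 2 * π + -π = π by ring,
          intervalIntegral.integral_of_le (by linarith [Real.pi_pos]), integral_Ioc_eq_integral_Ioo,
          Complex.real_smul]
        have : (π : ℂ) ≠ 0 := by exact_mod_cast Real.pi_ne_zero
        push_cast
        field_simp
      rw [havg, Complex.real_smul]
      rcases lt_or_gt_of_ne hne with hlt | hgt
      · rw [circleAverage_inv_sub_of_lt hρ hlt, indicator_of_mem (mem_Iio.2 hlt)]
      · rw [circleAverage_inv_sub_of_gt hζ hgt, indicator_of_notMem (by simp [hgt.le])]
        simp
    · have : ρ ∉ Iio ‖ζ‖ := by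
        simp only [mem_Iio, not_lt] at *
        linarith
      simp [hR, this]
  rw [← integral_indicator measurableSet_ball, ← hf, ← Complex.integral_comp_polarCoord_symm,
    polarCoord_target, Measure.volume_eq_prod, setIntegral_prod _ hGi]
  have hae : ∀ᵐ ρ : ℝ ∂volume.restrict (Ioi 0),
      ∫ θ in Ioo (-π) π, ρ • f (Complex.polarCoord.symm (ρ, θ))
        = (Iio ‖ζ‖).indicator (fun ρ : ℝ => (ρ : ℂ) * (2 * π * ζ⁻¹)) ρ := by
    filter_upwards [ae_restrict_mem measurableSet_Ioi,
      ae_restrict_of_ae (Measure.ae_ne volume ‖ζ‖)] with ρ h1 h2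
    exact hinner ρ h1 h2
  rw [integral_congr_ae hae, setIntegral_indicator measurableSet_Iio, Ioi_inter_Iio,
    ← integral_Ioc_eq_integral_Ioo, ← intervalIntegral.integral_of_le (norm_nonneg _),
    intervalIntegral.integral_mul_const, intervalIntegral.integral_ofReal, integral_id]
  have hc : ζ * (starRingEnd ℂ) ζ = (‖ζ‖ : ℂ) ^ 2 := Complex.mul_conj' ζ
  push_cast
  rw [← hc]
  field_simp
  ring

/-- The total winding of a closed curve, integrated over a large disk. -/
lemma setIntegral_windingIntegral {z : ℝ → ℂ} (hz : IsClosedCurve z) (h0 : (0:ℂ) ∉ range z)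
    {R : ℝ} (hR : ∀ β, ‖z β‖ < R) :
    ∫ w in Metric.ball (0:ℂ) R, windingIntegral z w
      = π * ∫ β in (0:ℝ)..(2 * π), (starRingEnd ℂ) (z β) * deriv z β := by
  have hmeas : Measurable (Function.uncurry fun (β : ℝ) (w : ℂ) => deriv z β / (z β - w)) :=
    (hz.continuous_deriv.measurable.comp measurable_fst).div
      ((hz.1.continuous.measurable.comp measurable_fst).sub measurable_snd)
  obtain ⟨M, hM⟩ := (isCompact_Icc (a := (0:ℝ)) (b := 2 * π)).exists_bound_of_continuousOn
    hz.continuous_deriv.continuousOn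
  have hint : ∀ β, Integrable (fun w => deriv z β / (z β - w))
      (volume.restrict (Metric.ball (0:ℂ) R)) := fun β => by
    simp only [div_eq_mul_inv]
    exact (integrableOn_inv_sub_ball (hR β)).const_mul _
  have hI : Integrable (Function.uncurry fun (β : ℝ) (w : ℂ) => deriv z β / (z β - w))
      ((volume.restrict (uIoc 0 (2 * π))).prod (volume.restrict (Metric.ball (0:ℂ) R))) := by
    rw [integrable_prod_iff hmeas.aestronglyMeasurable]
    refine ⟨Eventually.of_forall hint, ?_⟩
    refine Integrable.mono' (g := fun _ => M * ∫ w in Metric.ball (0:ℂ) (2 * R), ‖w‖⁻¹)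
      (by rw [uIoc_of_le Real.two_pi_pos.le]; exact integrable_const _)
      hmeas.aestronglyMeasurable.norm.integral_prod_right' ?_
    filter_upwards [ae_restrict_mem measurableSet_uIoc] with β hβ
    rw [uIoc_of_le Real.two_pi_pos.le] at hβ
    rw [Real.norm_of_nonneg (integral_nonneg fun _ => norm_nonneg _)]
    simp only [Function.uncurry_apply_pair, div_eq_mul_inv, norm_mul, norm_inv]
    rw [integral_const_mul]
    refine mul_le_mul (hM β (Ioc_subset_Icc_self hβ)) ?_
      (integral_nonneg fun _ => by positivity) ((norm_nonneg _).trans (hM β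
        (Ioc_subset_Icc_self hβ)))
    rw [← setIntegral_inv_norm_sub_ball (z β)]
    exact setIntegral_mono_set (integrableOn_inv_norm_sub_ball _ _)
      (Eventually.of_forall fun _ => by positivity)
      (ball_subset_ball_two_mul (hR β)).eventuallyLE
  simp only [windingIntegral]
  rw [← intervalIntegral_integral_swap hI, ← intervalIntegral.integral_const_mul]
  refine intervalIntegral.integral_congr fun β _ => ?_
  simp only [div_eq_mul_inv]
  rw [integral_const_mul, setIntegral_inv_sub_ball (fun h => h0 ⟨β, h⟩) (hR β)]
  ring

lemma IsClosedCurve.volume_range {z : ℝ → ℂ} (hz : IsClosedCurve z) :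
    volume (range z) = 0 := by
  have hre : range z = (fun w : ℂ => z w.re) '' univ := by
    rw [image_univ]
    exact (Complex.re_surjective.range_comp z).symm
  rw [hre]
  refine addHaar_image_eq_zero_of_det_fderivWithin_eq_zero volume
    (f' := fun w => (ContinuousLinearMap.toSpanSingleton ℝ (deriv z w.re)).comp Complex.reCLM)
    (fun w _ => ?_) fun w _ => ?_
  · exact ((hz.hasDerivAt w.re).hasFDerivAt.comp w
      Complex.reCLM.hasFDerivAt).hasFDerivWithinAt
  · by_contra hdet
    have hinj := (ContinuousLinearMap.toContinuousLinearEquivOfDetNeZero _ hdet).injective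
    have hI := @hinj Complex.I 0 (by simp)
    exact Complex.I_ne_zero hI

lemma intervalIntegral_conj_mul_deriv {z : ℝ → ℂ} (hz : IsClosedCurve z) {Ω : Set ℂ}
    (hΩ : IsOpen Ω) (hconn : IsPreconnected Ω) (hbdd : Bornology.IsBounded Ω)
    (hfr : frontier Ω = range z) (h0 : (0:ℂ) ∈ Ω)
    (hw : windingIntegral z 0 = 2 * π * Complex.I) (harea : volume Ω = ENNReal.ofReal π) :
    ∫ β in (0:ℝ)..(2 * π), (starRingEnd ℂ) (z β) * deriv z β = 2 * π * Complex.I := by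
  have hdΩ : Disjoint Ω (range z) := by
    rw [← hfr, disjoint_comm]
    exact disjoint_frontier_iff_isOpen.2 hΩ
  have hπ : (π : ℂ) ≠ 0 := by exact_mod_cast Real.pi_ne_zero
  have hne : windingIntegral z 0 ≠ 0 := by
    rw [hw]
    simp [Real.pi_ne_zero]
  obtain ⟨R, hR⟩ := (hbdd.union hz.isCompact_range.isBounded).subset_ball (0:ℂ)
  have hRz : ∀ β, ‖z β‖ < R := fun β => mem_ball_zero_iff.1 (hR (Or.inr ⟨β, rfl⟩))
  have hae : ∀ᵐ w ∂volume.restrict (Metric.ball (0:ℂ) R),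
      windingIntegral z w = Ω.indicator (fun _ => 2 * π * Complex.I) w := by
    have : ∀ᵐ w : ℂ, w ∉ range z := measure_eq_zero_iff_ae_notMem.1 hz.volume_range
    filter_upwards [ae_restrict_of_ae this] with w hwz
    by_cases hwΩ : w ∈ Ω
    · rw [indicator_of_mem hwΩ, ← hw]
      exact windingIntegral_eq_of_isPreconnected hz hconn hdΩ hwΩ h0
    · rw [indicator_of_notMem hwΩ]
      exact windingIntegral_eq_zero_of_notMem hz hΩ hconn hfr h0 hne hwΩ hwz
  have key := setIntegral_windingIntegral hz (disjoint_left.1 hdΩ h0) hRz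
  rw [integral_congr_ae hae, setIntegral_indicator hΩ.measurableSet,
    inter_eq_right.2 (subset_union_left.trans hR), setIntegral_const, Measure.real, harea,
    ENNReal.toReal_ofReal Real.pi_pos.le, Complex.real_smul] at key
  exact (mul_left_cancel₀ hπ key).symm

lemma IsClosedCurve.ne_of_mem_annulus {z : ℝ → ℂ} (hz : IsClosedCurve z) {α β ρ : ℝ}
    (hρ : 0 < ρ) (h1 : ρ ≤ |β - α|) (h2 : |β - α| ≤ π) : z β ≠ z α := by
  intro h
  have := hz.eq_of_abs_sub_lt h (by linarith [Real.pi_pos])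
  simp [this] at h1
  linarith

lemma IsClosedCurve.deriv_add_two_pi {z : ℝ → ℂ} (hz : IsClosedCurve z) (β : ℝ) :
    deriv z (β + 2 * π) = deriv z β := by
  rw [← deriv_comp_add_const]
  exact congrArg (deriv · β) (funext hz.2.1)

lemma isCompact_annulus (α ρ : ℝ) : IsCompact {β : ℝ | ρ ≤ |β - α| ∧ |β - α| ≤ π} := by
  refine (isCompact_closedBall α π).of_isClosed_subset ?_ fun β hβ => ?_
  · exact isClosed_Icc.preimage (f := fun β : ℝ => |β - α|) (by fun_prop)
  · exact Metric.mem_closedBall.2 (by rw [Real.dist_eq]; exact hβ.2)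

lemma IsClosedCurve.integrableOn_cauchy {z : ℝ → ℂ} (hz : IsClosedCurve z) {g : ℝ → ℂ}
    (hg : Continuous g) (α : ℝ) {ρ : ℝ} (hρ : 0 < ρ) :
    IntegrableOn (fun β => g β * deriv z β / (z β - z α))
      {β : ℝ | ρ < |β - α| ∧ |β - α| ≤ π} := by
  refine IntegrableOn.mono_set (ContinuousOn.integrableOn_compact (isCompact_annulus α ρ)
    ?_) fun β hβ => ⟨hβ.1.le, hβ.2⟩
  refine (hg.mul hz.continuous_deriv).continuousOn.div
    (hz.1.continuous.sub continuous_const).continuousOn fun β hβ => ?_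
  exact sub_ne_zero.2 (hz.ne_of_mem_annulus hρ hβ.1 hβ.2)

lemma measurableSet_annulus (α ρ : ℝ) :
    MeasurableSet {β : ℝ | ρ < |β - α| ∧ |β - α| ≤ π} :=
  measurableSet_Ioc.preimage (f := fun β : ℝ => |β - α|) (by fun_prop)

lemma tendsto_setIntegral_annulus {f : ℝ → ℂ} (hf : Continuous f)
    (hper : Function.Periodic f (2 * π)) (α : ℝ) :
    Tendsto (fun ρ : ℝ => ∫ β in {β : ℝ | ρ < |β - α| ∧ |β - α| ≤ π}, f β) (𝓝[>] (0:ℝ))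
      (𝓝 (∫ β in (0:ℝ)..(2 * π), f β)) := by
  have hI : IntegrableOn f (Icc (α - π) (α + π)) := hf.continuousOn.integrableOn_Icc
  have hlim : ∫ β in (0:ℝ)..(2 * π), f β = ∫ β in Icc (α - π) (α + π), f β := by
    have := hper.intervalIntegral_add_eq 0 (α - π)
    rw [zero_add] at this
    rw [this, show α - π + 2 * π = α + π by ring,
      intervalIntegral.integral_of_le (by linarith [Real.pi_pos]), integral_Icc_eq_integral_Ioc]
  rw [hlim, ← integral_indicator measurableSet_Icc]
  simp only [← integral_indicator (measurableSet_annulus α _)]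
  refine tendsto_integral_filter_of_dominated_convergence
    (fun β => ‖(Icc (α - π) (α + π)).indicator f β‖)
    (Eventually.of_forall fun ρ =>
      (hf.measurable.indicator (measurableSet_annulus α ρ)).aestronglyMeasurable)
    (Eventually.of_forall fun ρ => Eventually.of_forall fun β => ?_)
    ((integrable_indicator_iff measurableSet_Icc).2 hI).norm ?_
  · refine norm_indicator_le_of_subset (fun β hβ => ?_) f β
    have := abs_le.1 hβ.2
    exact ⟨by linarith, by linarith⟩
  · filter_upwards [Measure.ae_ne volume α] with β hβ
    refine tendsto_const_nhds.congr' ?_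
    filter_upwards [Ioo_mem_nhdsGT (abs_pos.2 (sub_ne_zero.2 hβ))] with ρ hρ
    have hiff : β ∈ {β : ℝ | ρ < |β - α| ∧ |β - α| ≤ π} ↔ β ∈ Icc (α - π) (α + π) := by
      simp only [mem_ofPred_eq, hρ.2, true_and, abs_le, mem_Icc]
      constructor <;> rintro ⟨h1, h2⟩ <;> constructor <;> linarith
    by_cases h : β ∈ Icc (α - π) (α + π)
    · rw [indicator_of_mem h, indicator_of_mem (hiff.2 h)]
    · rw [indicator_of_notMem h, indicator_of_notMem (mt hiff.1 h)]

/-- The commutator of the curve with its Hilbert transform is the constant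
`-(πi)⁻¹ ∫ g dz`. -/
lemma IsPV.mul_sub_eq {z g Hg Hzg : ℝ → ℂ} (hz : IsClosedCurve z) (hg : Continuous g)
    (hper : ∀ β, g (β + 2 * π) = g β) (h1 : IsPV z g Hg)
    (h2 : IsPV z (fun β => z β * g β) Hzg) (α : ℝ) :
    z α * Hg α - Hzg α
      = -(((π : ℂ) * Complex.I)⁻¹ * ∫ β in (0:ℝ)..(2 * π), g β * deriv z β) := by
  have hlim := ((h1 α).const_mul (z α)).sub (h2 α)
  have hint : Function.Periodic (fun β => g β * deriv z β) (2 * π) := fun β => by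
    simp only [hper, hz.deriv_add_two_pi]
  refine tendsto_nhds_unique hlim ?_
  refine (((tendsto_setIntegral_annulus (f := fun β => g β * deriv z β)
    (hg.mul hz.continuous_deriv) hint α).const_mul
    ((π : ℂ) * Complex.I)⁻¹).neg).congr' ?_
  filter_upwards [self_mem_nhdsWithin] with ρ hρ
  rw [mem_Ioi] at hρ
  have hS : ∫ β in {β : ℝ | ρ < |β - α| ∧ |β - α| ≤ π}, g β * deriv z β
      = (∫ β in {β : ℝ | ρ < |β - α| ∧ |β - α| ≤ π}, z β * g β * deriv z β / (z β - z α))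
        - z α * ∫ β in {β : ℝ | ρ < |β - α| ∧ |β - α| ≤ π},
          g β * deriv z β / (z β - z α) := by
    rw [← integral_const_mul, ← integral_sub
      (hz.integrableOn_cauchy (g := fun β => z β * g β) (hz.1.continuous.mul hg) α hρ)
      ((hz.integrableOn_cauchy hg α hρ).const_mul _)]
    refine setIntegral_congr_fun (measurableSet_annulus α ρ) fun β hβ => ?_
    have := sub_ne_zero.2 (hz.ne_of_mem_annulus hρ hβ.1.le hβ.2)
    field_simp
  rw [hS]
  ring

/-- With the area normalization `|Ω(t)| = π`, the average of `ε = |𝔷|² − 1`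
vanishes: `𝒜𝒱(ε) = (1/2)[𝔷, H](ε/𝔷) = 0`. -/
theorem average_of_epsilon_vanishes
    (I : Set ℝ)
    (𝔷 : ℝ → ℝ → ℂ)
    (hsm : ContDiffOn ℝ (⊤ : ℕ∞) (fun p : ℝ × ℝ => 𝔷 p.1 p.2) (I ×ˢ Set.univ))
    (hcurve : ∀ t ∈ I, IsClosedCurve (𝔷 t))
    (Ω : ℝ → Set ℂ)
    (hopen : ∀ t ∈ I, IsOpen (Ω t))
    (hbdd : ∀ t ∈ I, Bornology.IsBounded (Ω t))
    (hsc : ∀ t ∈ I, SimplyConnectedSpace (Ω t))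
    (h0 : ∀ t ∈ I, (0:ℂ) ∈ Ω t)
    (hfr : ∀ t ∈ I, frontier (Ω t) = Set.range (𝔷 t))
    (harea : ∀ t ∈ I, volume (Ω t) = ENNReal.ofReal Real.pi)
    (H : ℝ → (ℝ → ℂ) → ℝ → ℂ) (hH : ∀ t ∈ I, IsHT (𝔷 t) (H t))
    (hholo : ∀ t ∈ I, ∀ α : ℝ,
      H t (fun β => (starRingEnd ℂ) (deriv (fun s => 𝔷 s β) t)) α
        = (starRingEnd ℂ) (deriv (fun s => 𝔷 s α) t))
    (k : ℝ → ℝ → ℝ)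
    (hksm : ContDiffOn ℝ (⊤ : ℕ∞) (fun p : ℝ × ℝ => k p.1 p.2) (I ×ˢ Set.univ))
    (hkper : ∀ t α, k t (α + 2*Real.pi) = k t α + 2*Real.pi)
    (L : ℝ → ℝ → ℂ)
    (hLsm : ContDiffOn ℝ (⊤ : ℕ∞) (fun p : ℝ × ℝ => L p.1 p.2) (I ×ˢ Set.univ))
    (hLper : ∀ t α, L t (α + 2*Real.pi) = L t α)
    (hLexp : ∀ t ∈ I, ∀ α : ℝ,
      Complex.exp (L t α)
        = (starRingEnd ℂ) (𝔷 t α) * Complex.exp (Complex.I * (k t α : ℂ)))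
    (hLH : ∀ t ∈ I, ∀ α : ℝ, H t (L t) α = L t α)
    (F : ℝ → ℂ → ℂ)
    (hFholo : ∀ t ∈ I, DifferentiableOn ℂ (F t) (Ω t))
    (hFne : ∀ t ∈ I, ∀ w ∈ Ω t, F t w ≠ 0)
    (hFcont : ∀ t ∈ I, ContinuousOn (F t) (closure (Ω t)))
    (hFbd : ∀ t ∈ I, ∀ α : ℝ,
      F t (𝔷 t α) = (starRingEnd ℂ) (𝔷 t α) * Complex.exp (Complex.I * (k t α : ℂ)))
    (hF0 : ∀ t ∈ I, ∃ r : ℝ, 0 < r ∧ F t 0 = (r : ℂ)) :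
    ∀ t ∈ I, ∀ α : ℝ,
      (1/2 : ℂ) * commH (H t) (𝔷 t)
          (fun β => (𝔷 t β * (starRingEnd ℂ) (𝔷 t β) - 1) / 𝔷 t β) α = 0 := by
  intro t ht α
  have hz := hcurve t ht
  have hconn : IsPreconnected (Ω t) := by
    have := hsc t ht
    exact isPreconnected_iff_preconnectedSpace.2 inferInstance
  have hzero : (0:ℂ) ∉ range (𝔷 t) := by
    rw [← hfr t ht]
    exact disjoint_right.1 (disjoint_frontier_iff_isOpen.2 (hopen t ht)) (h0 t ht)
  have hne : ∀ β, 𝔷 t β ≠ 0 := fun β h => hzero ⟨β, h⟩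
  have hslice : ContDiff ℝ (⊤ : ℕ∞) fun β : ℝ => (t, β) := contDiff_const.prodMk contDiff_id
  have hmaps : MapsTo (fun β : ℝ => (t, β)) univ (I ×ˢ univ) := fun _ _ => ⟨ht, trivial⟩
  have hk : ContDiff ℝ (⊤ : ℕ∞) (k t) :=
    contDiffOn_univ.1 (hksm.comp hslice.contDiffOn hmaps)
  have hL : ContDiff ℝ (⊤ : ℕ∞) (L t) :=
    contDiffOn_univ.1 (hLsm.comp hslice.contDiffOn hmaps)
  have hwind : windingIntegral (𝔷 t) 0 = 2 * π * Complex.I :=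
    windingIntegral_zero_of_exp_eq hz hzero (hk.of_le (by exact_mod_cast le_top))
      (by simpa using hkper t 0) (hL.of_le (by exact_mod_cast le_top))
      (by simpa using hLper t 0) (hLexp t ht)
  have harea' := intervalIntegral_conj_mul_deriv hz (hopen t ht) hconn (hbdd t ht) (hfr t ht)
    (h0 t ht) hwind (harea t ht)
  have hconj : ContDiff ℝ (⊤ : ℕ∞) fun β => (starRingEnd ℂ) (𝔷 t β) :=
    Complex.conjCLE.contDiff.comp hz.1
  set g : ℝ → ℂ := fun β => (𝔷 t β * (starRingEnd ℂ) (𝔷 t β) - 1) / 𝔷 t β with hg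
  have hgsm : ContDiff ℝ (⊤ : ℕ∞) g := by
    simp only [hg, div_eq_mul_inv]
    exact ((hz.1.mul hconj).sub contDiff_const).mul (hz.1.inv hne)
  have hgper : ∀ β, g (β + 2 * π) = g β := fun β => by simp only [hg, hz.2.1]
  have hcomm := IsPV.mul_sub_eq hz hgsm.continuous hgper (hH t ht g hgsm hgper)
    (hH t ht (fun β => 𝔷 t β * g β) (hz.1.mul hgsm) fun β => by simp only [hgper, hz.2.1]) α
  have hint : ∫ β in (0:ℝ)..(2 * π), g β * deriv (𝔷 t) β = 0 := by
    have hsplit : ∀ β, g β * deriv (𝔷 t) β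
        = (starRingEnd ℂ) (𝔷 t β) * deriv (𝔷 t) β - deriv (𝔷 t) β / (𝔷 t β - 0) := fun β => by
      have := hne β
      simp only [hg, sub_zero]
      field_simp
    simp only [hsplit]
    have h1 : Continuous fun β => (starRingEnd ℂ) (𝔷 t β) * deriv (𝔷 t) β :=
      hconj.continuous.mul hz.continuous_deriv
    have h2 : Continuous fun β => deriv (𝔷 t) β / (𝔷 t β - 0) :=
      hz.continuous_deriv.div (hz.1.continuous.sub continuous_const)
        fun β => by simpa using hne β
    rw [intervalIntegral.integral_sub (h1.intervalIntegrable _ _) (h2.intervalIntegrable _ _),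
      harea']
    exact sub_eq_zero.2 hwind.symm
  rw [commH, hcomm, hint]
  simp
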